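/- Let S be a nonempty finite word over the alphabet [m] and let S' be the reversal of S. Then for every integer n ≥ 1, E(Y^n) computed for S' equals E(Y^n) computed for S, i.e. ∑_{w ∈ Z(S')} |w|^n · P(w) = ∑_{w ∈ Z(S)} |w|^n · P(w). -/

import Mathlib

/-- The probability of a given finite word over the alphabet `Fin m`, where face `i`
has probability `p i`. -/
def dieP {m : ℕ} (p : Fin m → ℝ) (w : List (Fin m)) : ℝ := (w.map p).prod

/-- The number of occurrences of `S` as a factor (consecutive subword) of `w`. -/
def numOccs {m : ℕ} (S w : List (Fin m)) : ℕ :=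
  ((Finset.range (w.length + 1)).filter fun i => (w.drop i).take S.length = S).card

/-- `dieZ S` is the set of finite words over `Fin m` in which `S` occurs exactly once
as a factor, namely as a suffix. -/
def dieZ {m : ℕ} (S : List (Fin m)) : Set (List (Fin m)) := {w | S <:+ w ∧ numOccs S w = 1}

/-- The lengths, shifted down by one, of the overlaps of `S`, i.e. of the nonempty words
that are simultaneously a prefix and a suffix of `S`.  The overlap of `S` of length
`i + 1` (for `i ∈ overlapLens S`) is `S.take (i + 1)`, so that summation over the set of
overlaps of `S` is summation of `S.take (i + 1)` over `i ∈ overlapLens S`. -/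
def overlapLens {m : ℕ} (S : List (Fin m)) : Finset ℕ :=
  (Finset.range S.length).filter fun i => S.take (i + 1) <:+ S

/-- The expected number of die rolls `E(S) = ∑_{w ∈ Z(S)} |w| P(w)` needed to produce `S`. -/
noncomputable def dieE {m : ℕ} (p : Fin m → ℝ) (S : List (Fin m)) : ℝ :=
  ∑' w : dieZ S, (w.1.length : ℝ) * dieP p w.1

theorem take_drop_eq_iff {α : Type*} {S w : List α} {i : ℕ} :
    (i ∈ Finset.range (w.length + 1) ∧ (w.drop i).take S.length = S) ↔
      ∃ a b, a ++ S ++ b = w ∧ a.length = i := by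
  constructor
  · rintro ⟨hi, h⟩
    refine ⟨w.take i, (w.drop i).drop S.length, ?_, ?_⟩
    · conv_lhs => enter [1, 2]; rw [← h]
      rw [List.append_assoc, List.take_append_drop, List.take_append_drop]
    · have := Finset.mem_range.1 hi
      rw [List.length_take]
      omega
  · rintro ⟨a, b, rfl, rfl⟩
    refine ⟨Finset.mem_range.2 ?_, ?_⟩
    · simp only [List.length_append]
      omega
    · simp

theorem mem_dieZ_iff {m : ℕ} {S : List (Fin m)} (hS : S ≠ []) {w : List (Fin m)} :
    w ∈ dieZ S ↔ S <:+: w ∧ ¬ S <:+: w.dropLast := by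
  have hpos : 0 < S.length := List.length_pos_iff.2 hS
  constructor
  · rintro ⟨⟨a, rfl⟩, hcard⟩
    refine ⟨⟨a, [], by simp⟩, ?_⟩
    rintro ⟨c, d, hcd⟩
    obtain ⟨k, hk⟩ := Finset.card_eq_one.1 hcard
    have hne : a ++ S ≠ [] := by simp [hS]
    have key : ∀ i, (∃ u v, u ++ S ++ v = a ++ S ∧ u.length = i) → i = k := fun i hi => by
      rw [← Finset.mem_singleton, ← hk, Finset.mem_filter]
      exact take_drop_eq_iff.2 hi
    have h1 := key a.length ⟨a, [], by simp, rfl⟩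
    have h2 := key c.length ⟨c, d ++ [(a ++ S).getLast hne], by
      rw [← List.append_assoc, hcd, List.dropLast_append_getLast], rfl⟩
    have h3 := congrArg List.length hcd
    simp only [List.length_append, List.length_dropLast] at h3
    omega
  · rintro ⟨⟨a, b, rfl⟩, h⟩
    have key : ∀ u v, u ++ S ++ v = a ++ S ++ b → v = [] := by
      intro u v huv
      by_contra hv
      apply h
      rw [← huv, List.dropLast_append_of_ne_nil hv]
      exact ⟨u, v.dropLast, rfl⟩
    obtain rfl := key a b rfl
    rw [List.append_nil] at key ⊢
    refine ⟨⟨a, rfl⟩, Finset.card_eq_one.2 ⟨a.length, ?_⟩⟩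
    ext i
    rw [Finset.mem_filter, take_drop_eq_iff, Finset.mem_singleton]
    constructor
    · rintro ⟨u, v, huv, rfl⟩
      obtain rfl := key u v huv
      rw [List.append_nil] at huv
      rw [List.append_cancel_right huv]
    · rintro rfl
      exact ⟨a, [], by simp, rfl⟩

/-- Reverse all of a word except its last letter, which stays in place. -/
def reverseInit {α : Type*} (w : List α) : List α := w.dropLast.reverse ++ w.getLast?.toList

theorem reverseInit_concat {α : Type*} (w : List α) (x : α) :
    reverseInit (w ++ [x]) = w.reverse ++ [x] := by
  simp [reverseInit]

theorem reverseInit_involutive {α : Type*} :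
    Function.Involutive (reverseInit : List α → List α) := by
  intro w
  induction w using List.reverseRecOn with
  | nil => rfl
  | append_singleton w x => simp [reverseInit_concat]

theorem reverseInit_perm {α : Type*} (w : List α) : (reverseInit w).Perm w := by
  induction w using List.reverseRecOn with
  | nil => rfl
  | append_singleton w x =>
    rw [reverseInit_concat]
    exact (List.reverse_perm w).append_right [x]

theorem dropLast_reverseInit {α : Type*} (w : List α) :
    (reverseInit w).dropLast = w.dropLast.reverse := by
  induction w using List.reverseRecOn with
  | nil => rfl
  | append_singleton w x => simp [reverseInit_concat]

theorem finite_setOf_coe_eq {α : Type*} (c : Multiset α) :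
    {w : List α | (w : Multiset α) = c}.Finite := by
  classical
  induction c using Quotient.inductionOn with
  | h l =>
    refine l.permutations.toFinset.finite_toSet.subset fun w hw => ?_
    simpa using Multiset.coe_eq_coe.1 hw

/-- Among the words with a given multiset of letters, the number of those which complete their
first occurrence of `S` with their last letter is invariant under reversal of `S`. -/
theorem ncard_first_occurrence_reverse {α : Type*} (S : List α) (c : Multiset α) :
    {w : List α | (S.reverse <:+: w ∧ ¬ S.reverse <:+: w.dropLast) ∧ (w : Multiset α) = c}.ncard =
      {w : List α | (S <:+: w ∧ ¬ S <:+: w.dropLast) ∧ (w : Multiset α) = c}.ncard := by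
  have hdiff (T : List α) :
      {w : List α | (T <:+: w ∧ ¬ T <:+: w.dropLast) ∧ (w : Multiset α) = c} =
        {w : List α | ¬ T <:+: w.dropLast ∧ (w : Multiset α) = c} \
          {w : List α | ¬ T <:+: w ∧ (w : Multiset α) = c} := by
    ext w
    simp only [Set.mem_setOf_eq, Set.mem_diff]
    tauto
  have hsub (T : List α) : {w : List α | ¬ T <:+: w ∧ (w : Multiset α) = c} ⊆
      {w : List α | ¬ T <:+: w.dropLast ∧ (w : Multiset α) = c} :=
    fun w hw => ⟨fun h => hw.1 (h.trans w.dropLast_prefix.isInfix), hw.2⟩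
  have hfin (T : List α) : {w : List α | ¬ T <:+: w ∧ (w : Multiset α) = c}.Finite :=
    (finite_setOf_coe_eq c).subset fun w hw => hw.2
  rw [hdiff, hdiff, Set.ncard_diff (hsub _) (hfin _), Set.ncard_diff (hsub _) (hfin _)]
  congr 1
  · rw [← Set.ncard_image_of_injective _ reverseInit_involutive.injective,
      reverseInit_involutive.image_eq_preimage_symm]
    congr 1
    ext w
    simp only [Set.mem_preimage, Set.mem_setOf_eq, dropLast_reverseInit, List.reverse_infix,
      Multiset.coe_eq_coe.2 (reverseInit_perm w)]
  · rw [← Set.ncard_image_of_injective _ List.reverse_injective,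
      List.reverse_involutive.image_eq_preimage_symm]
    congr 1
    ext w
    simp only [Set.mem_preimage, Set.mem_setOf_eq, List.reverse_infix, Multiset.coe_reverse]

theorem exists_dieZ_reverse_equiv_perm {m : ℕ} {S : List (Fin m)} (hS : S ≠ []) :
    ∃ e : dieZ S.reverse ≃ dieZ S, ∀ w, (e w).1.Perm w.1 := by
  have hcard (T : List (Fin m)) (hT : T ≠ []) (c : Multiset (Fin m)) :
      Nat.card {w : dieZ T // (w.1 : Multiset (Fin m)) = c} =
        {w : List (Fin m) |
          (T <:+: w ∧ ¬ T <:+: w.dropLast) ∧ (w : Multiset (Fin m)) = c}.ncard := by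
    rw [← Nat.card_coe_set_eq]
    simp only [← mem_dieZ_iff hT]
    exact Nat.card_congr (Equiv.subtypeSubtypeEquivSubtypeInter (· ∈ dieZ T)
      fun w => (w : Multiset (Fin m)) = c)
  have hfin (T : List (Fin m)) (c : Multiset (Fin m)) :
      Finite {w : dieZ T // (w.1 : Multiset (Fin m)) = c} :=
    have := (finite_setOf_coe_eq c).to_subtype
    Finite.of_injective (β := {w : List (Fin m) | (w : Multiset (Fin m)) = c})
      (fun w => ⟨w.1.1, w.2⟩) fun u v h => Subtype.ext (Subtype.ext (by simpa using h))
  have e (c : Multiset (Fin m)) :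
      Nonempty ({w : dieZ S.reverse // (w.1 : Multiset (Fin m)) = c} ≃
        {w : dieZ S // (w.1 : Multiset (Fin m)) = c}) := by
    have := hfin S c
    have := hfin S.reverse c
    rw [← Finite.card_eq, hcard _ (by simpa using hS), hcard _ hS, ncard_first_occurrence_reverse]
  exact ⟨Equiv.ofFiberEquiv fun c => (e c).some, fun w =>
    Multiset.coe_eq_coe.1 (Equiv.ofFiberEquiv_map (fun c => (e c).some) w)⟩

/-- The moment `E(Y^n)` is unchanged when `S` is reversed. -/
theorem stmt_18 (m : ℕ) (hm : 1 ≤ m) (p : Fin m → ℝ) (hp : ∀ i, 0 < p i)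
    (hsum : ∑ i, p i = 1) (S : List (Fin m)) (hS : S ≠ []) (n : ℕ) (hn : 1 ≤ n) :
    ∑' w : dieZ S.reverse, (w.1.length : ℝ) ^ n * dieP p w.1 =
      ∑' w : dieZ S, (w.1.length : ℝ) ^ n * dieP p w.1 := by
  obtain ⟨e, he⟩ := exists_dieZ_reverse_equiv_perm hS
  rw [← e.tsum_eq]
  refine tsum_congr fun w => ?_
  rw [(he w).length_eq, dieP, dieP, ((he w).map p).prod_eq]
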